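/- Let 1 < p < ∞, 1/p + 1/p′ = 1, and let Q₀ ⊂ ℝⁿ be a cube with sides parallel to the coordinate axes. Let f ∈ L¹(Q₀) with f ≥ 0 and GaRo_p(f,Q₀) < ∞. Then for every t with 0 < t < |Q₀|/4, t ( f**(t) − f*(t) ) ≤ 2^{n/p′+1} · GaRo_p(f,Q₀) · t^{1/p′}; in particular sup_{0 < t ≤ |Q₀|/4} t^{1/p}( f**(t) − f*(t) ) ≤ 2^{n/p′+1} GaRo_p(f,Q₀). -/

import Mathlib

open MeasureTheory Set
open scoped ENNReal NNReal

noncomputable section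

/-- The distribution function `λ_f(t) = μ {x : |f(x)| > t}`. -/
def distFun {α : Type*} [MeasurableSpace α] (μ : Measure α) (f : α → ℝ) (t : ℝ) : ℝ≥0∞ :=
  μ {x | t < |f x|}

/-- The non-increasing rearrangement `f*(t) = inf {s > 0 : λ_f(s) ≤ t}`. -/
def rearr {α : Type*} [MeasurableSpace α] (μ : Measure α) (f : α → ℝ) (t : ℝ) : ℝ≥0∞ :=
  sInf (ENNReal.ofReal '' {s : ℝ | 0 < s ∧ distFun μ f s ≤ ENNReal.ofReal t})

/-- The maximal function `f**(t) = (1/t) ∫₀ᵗ f*(s) ds`. -/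
def dstar {α : Type*} [MeasurableSpace α] (μ : Measure α) (f : α → ℝ) (t : ℝ) : ℝ≥0∞ :=
  (∫⁻ s in Set.Ioc (0 : ℝ) t, rearr μ f s) / ENNReal.ofReal t

/-- The `L(∞,∞)` "norm" : `sup_{t>0} (f**(t) - f*(t))`. -/
def oscNorm {α : Type*} [MeasurableSpace α] (μ : Measure α) (f : α → ℝ) : ℝ≥0∞ :=
  ⨆ (t : ℝ) (_ : 0 < t), dstar μ f t - rearr μ f t

/-- The Marcinkiewicz `L(p,∞)` quasinorm `‖f‖*_{L(p,∞)} = sup_{t>0} t (λ_f(t))^{1/p}`. -/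
def wkNorm {α : Type*} [MeasurableSpace α] (μ : Measure α) (p : ℝ) (f : α → ℝ) : ℝ≥0∞ :=
  ⨆ (t : ℝ) (_ : 0 < t), ENNReal.ofReal t * distFun μ f t ^ (1 / p)

/-- `‖f‖_{L(p,∞)} = sup_{s>0} s^{1/p} f**(s)`. -/
def wkNormStarStar {α : Type*} [MeasurableSpace α] (μ : Measure α) (p : ℝ) (f : α → ℝ) : ℝ≥0∞ :=
  ⨆ (s : ℝ) (_ : 0 < s), ENNReal.ofReal s ^ (1 / p) * dstar μ f s

/-- `‖f‖*_{L(p,∞)} = sup_{s>0} s^{1/p} f*(s)` (rearrangement form). -/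
def wkNormStar {α : Type*} [MeasurableSpace α] (μ : Measure α) (p : ℝ) (f : α → ℝ) : ℝ≥0∞ :=
  ⨆ (s : ℝ) (_ : 0 < s), ENNReal.ofReal s ^ (1 / p) * rearr μ f s

/-- `‖f‖^#_{L(p,∞)} = sup_{s>0} s^{1/p} (f**(s) - f*(s))`. -/
def sharpNorm {α : Type*} [MeasurableSpace α] (μ : Measure α) (p : ℝ) (f : α → ℝ) : ℝ≥0∞ :=
  ⨆ (s : ℝ) (_ : 0 < s), ENNReal.ofReal s ^ (1 / p) * (dstar μ f s - rearr μ f s)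

/-- `‖f‖^{##}_{L(p,∞)} = sup_{t>0} (λ_f(t))^{-(1-1/p)} ∫_t^∞ λ_f(s) ds`. -/
def sharpSharpNorm {α : Type*} [MeasurableSpace α] (μ : Measure α) (p : ℝ) (f : α → ℝ) : ℝ≥0∞ :=
  ⨆ (t : ℝ) (_ : 0 < t),
    distFun μ f t ^ (-(1 - 1 / p)) * ∫⁻ s in Set.Ioi t, distFun μ f s

/-- `‖f‖^{##}_{L(∞,∞)} = inf {C : ∫_t^∞ λ_f(s) ds ≤ C λ_f(t) for all t > 0}`. -/
def sharpSharpInf {α : Type*} [MeasurableSpace α] (μ : Measure α) (f : α → ℝ) : ℝ≥0∞ :=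
  sInf {C : ℝ≥0∞ | ∀ t : ℝ, 0 < t →
    ∫⁻ s in Set.Ioi t, distFun μ f s ≤ C * distFun μ f t}

/-- O'Neil's quantity `inf {C^{1/p} : ∫_t^∞ λ_f(s) ds ≤ C t^{1-p} for all t > 0}`. -/
def oneilQuantity {α : Type*} [MeasurableSpace α] (μ : Measure α) (p : ℝ) (f : α → ℝ) : ℝ≥0∞ :=
  sInf {D : ℝ≥0∞ | ∃ C : ℝ≥0∞, D = C ^ (1 / p) ∧
    ∀ t : ℝ, 0 < t → ∫⁻ s in Set.Ioi t, distFun μ f s ≤ C * ENNReal.ofReal t ^ (1 - p)}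

/-- A cube in `ℝⁿ` with sides parallel to the coordinate axes. -/
def IsCube {n : ℕ} (Q : Set (Fin n → ℝ)) : Prop :=
  ∃ (a : Fin n → ℝ) (l : ℝ), 0 < l ∧ Q = Set.univ.pi fun i => Set.Icc (a i) (a i + l)

/-- A countable family of subcubes of `Q₀` with pairwise disjoint interiors. -/
def IsPackingIn {n : ℕ} (Q₀ : Set (Fin n → ℝ)) (Q : ℕ → Set (Fin n → ℝ)) : Prop :=
  (∀ i, IsCube (Q i) ∧ Q i ⊆ Q₀) ∧
    Pairwise fun i j => interior (Q i) ∩ interior (Q j) = ∅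

/-- The average `f_Q = (1/|Q|) ∫_Q f`. -/
def cubeAvg {n : ℕ} (f : (Fin n → ℝ) → ℝ) (Q : Set (Fin n → ℝ)) : ℝ :=
  ⨍ x in Q, f x

/-- The mean oscillation `(1/|Q|) ∫_Q |f - f_Q|`. -/
def meanOsc {n : ℕ} (f : (Fin n → ℝ) → ℝ) (Q : Set (Fin n → ℝ)) : ℝ :=
  ⨍ x in Q, |f x - cubeAvg f Q|

/-- The John–Nirenberg functional `JN_p(f,Q₀)`. -/
def JN {n : ℕ} (p : ℝ) (f : (Fin n → ℝ) → ℝ) (Q₀ : Set (Fin n → ℝ)) : ℝ≥0∞ :=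
  ⨆ (Q : ℕ → Set (Fin n → ℝ)) (_ : IsPackingIn Q₀ Q),
    (∑' i, volume (Q i) * ENNReal.ofReal (meanOsc f (Q i)) ^ p) ^ (1 / p)

/-- The BMO norm `‖f‖_{BMO(Q₀)}`. -/
def bmoNorm {n : ℕ} (f : (Fin n → ℝ) → ℝ) (Q₀ : Set (Fin n → ℝ)) : ℝ≥0∞ :=
  ⨆ (Q : Set (Fin n → ℝ)) (_ : IsCube Q ∧ Q ⊆ Q₀), ENNReal.ofReal (meanOsc f Q)

/-- The Garsia–Rodemich functional `GaRo_p(f,Q₀)`: the least constant `C` such that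
for every packing `{Qᵢ}` of `Q₀`,
`Σᵢ (1/|Qᵢ|) ∫_{Qᵢ}∫_{Qᵢ} |f(x)-f(y)| dx dy ≤ C (Σᵢ |Qᵢ|)^{1/p'}` where `1/p' = 1 - 1/p`. -/
def GaRo {n : ℕ} (p : ℝ) (f : (Fin n → ℝ) → ℝ) (Q₀ : Set (Fin n → ℝ)) : ℝ≥0∞ :=
  sInf {C : ℝ≥0∞ | ∀ Q : ℕ → Set (Fin n → ℝ), IsPackingIn Q₀ Q →
    (∑' i, (volume (Q i))⁻¹ *
        ∫⁻ x in Q i, ∫⁻ y in Q i, ENNReal.ofReal |f x - f y|) ≤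
      C * (∑' i, volume (Q i)) ^ (1 - 1 / p)}

/-- `C` satisfies the Garsia–Rodemich inequality for all packings of `Q₀`. -/
def IsGaRoBound {n : ℕ} (p : ℝ) (f : (Fin n → ℝ) → ℝ) (Q₀ : Set (Fin n → ℝ)) (C : ℝ≥0∞) : Prop :=
  ∀ Q : ℕ → Set (Fin n → ℝ), IsPackingIn Q₀ Q →
    (∑' i, (volume (Q i))⁻¹ *
        ∫⁻ x in Q i, ∫⁻ y in Q i, ENNReal.ofReal |f x - f y|) ≤
      C * (∑' i, volume (Q i)) ^ (1 - 1 / p)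

/-- The half-open cube with lower corner `a` and side length `l`. -/
def hcube {n : ℕ} (a : Fin n → ℝ) (l : ℝ) : Set (Fin n → ℝ) :=
  Set.univ.pi fun i => Set.Ico (a i) (a i + l)

/-- The closed cube with lower corner `a` and side length `l`. -/
def ccube {n : ℕ} (a : Fin n → ℝ) (l : ℝ) : Set (Fin n → ℝ) :=
  Set.univ.pi fun i => Set.Icc (a i) (a i + l)

lemma measurableSet_hcube {n : ℕ} (a : Fin n → ℝ) (l : ℝ) : MeasurableSet (hcube a l) :=
  MeasurableSet.univ_pi fun _ => measurableSet_Ico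

lemma volume_hcube {n : ℕ} (a : Fin n → ℝ) (l : ℝ) :
    volume (hcube a l) = ENNReal.ofReal l ^ n := by
  simp [hcube, Real.volume_pi_Ico]

lemma volume_ccube {n : ℕ} (a : Fin n → ℝ) (l : ℝ) :
    volume (ccube a l) = ENNReal.ofReal l ^ n := by
  rw [ccube, volume_pi_pi]
  simp

lemma hcube_ae_eq_ccube {n : ℕ} (a : Fin n → ℝ) (l : ℝ) :
    hcube a l =ᵐ[volume] ccube a l := by
  have h := Measure.univ_pi_Ico_ae_eq_Icc (μ := fun _ : Fin n => (volume : Measure ℝ))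
    (f := a) (g := fun i => a i + l)
  rwa [← pi_univ_Icc] at h

lemma volume_hcube_ne_zero {n : ℕ} (a : Fin n → ℝ) {l : ℝ} (hl : 0 < l) :
    volume (hcube a l) ≠ 0 := by
  rw [volume_hcube]
  exact pow_ne_zero _ (by simpa using hl)

lemma volume_hcube_ne_top {n : ℕ} (a : Fin n → ℝ) (l : ℝ) :
    volume (hcube a l) ≠ ⊤ := by
  rw [volume_hcube]
  exact ENNReal.pow_ne_top ENNReal.ofReal_ne_top

lemma interior_ccube {n : ℕ} (a : Fin n → ℝ) (l : ℝ) :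
    interior (ccube a l) = Set.univ.pi fun i => Set.Ioo (a i) (a i + l) := by
  rw [ccube, interior_pi_set Set.finite_univ]
  simp only [interior_Icc]

lemma volume_interior_ccube {n : ℕ} (a : Fin n → ℝ) (l : ℝ) :
    volume (interior (ccube a l)) = volume (ccube a l) := by
  rw [interior_ccube, volume_ccube]
  simp [volume_pi_pi]

/-- The closed cubes strung along the diagonal of the half-open cube with corner `c` and side `r`,
with sides `r * ε ^ k * (1 - ε)`. -/
def diagCube {n : ℕ} (c : Fin n → ℝ) (r ε : ℝ) (k : ℕ) : Set (Fin n → ℝ) :=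
  ccube (fun i => c i + r * (1 - ε ^ k)) (r * (ε ^ k * (1 - ε)))

lemma diagCube_subset {n : ℕ} (c : Fin n → ℝ) {r ε : ℝ} (hr : 0 < r) (h0 : 0 < ε) (h1 : ε < 1)
    (k : ℕ) : diagCube c r ε k ⊆ hcube c r := by
  intro x hx i _
  obtain ⟨hx1, hx2⟩ := hx i trivial
  have hk : 0 < ε ^ k := pow_pos h0 k
  have hk1 : ε ^ k ≤ 1 := pow_le_one₀ h0.le h1.le
  constructor
  · nlinarith
  · have : 0 < r * (ε ^ k * ε) := by positivity
    simp only at hx2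
    nlinarith

lemma diagCube_interior_disjoint {n : ℕ} (hn : n ≠ 0) (c : Fin n → ℝ) {r ε : ℝ} (hr : 0 < r)
    (h0 : 0 < ε) (h1 : ε < 1) {j k : ℕ} (hjk : j < k) :
    Disjoint (interior (diagCube c r ε j)) (interior (diagCube c r ε k)) := by
  rw [Set.disjoint_left]
  intro x hx hx'
  rw [diagCube, interior_ccube] at hx hx'
  have i : Fin n := ⟨0, Nat.pos_of_ne_zero hn⟩
  have h2 := (hx i trivial).2
  have h3 := (hx' i trivial).1
  have h4 : ε ^ k ≤ ε ^ (j + 1) := pow_le_pow_of_le_one h0.le h1.le hjk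
  rw [pow_succ] at h4
  nlinarith [mul_le_mul_of_nonneg_left h4 hr.le]

/-- The Garsia–Rodemich sum over cubes shrunk by the factor `1 - ε`. The room left in each cube is
filled with smaller cubes to produce an infinite packing. -/
lemma IsGaRoBound.tsum_shrunk_le {n : ℕ} (hn : n ≠ 0) {p : ℝ} (hp : 1 < p)
    {f : (Fin n → ℝ) → ℝ} {Q₀ : Set (Fin n → ℝ)} {C : ℝ≥0∞} (hC : IsGaRoBound p f Q₀ C)
    {ι : Type*} [Countable ι] (c : ι → Fin n → ℝ) (r : ι → ℝ) (hr : ∀ i, 0 < r i)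
    (hd : Pairwise fun i j => Disjoint (hcube (c i) (r i)) (hcube (c j) (r j)))
    (hsub : ∀ i, hcube (c i) (r i) ⊆ Q₀) {ε : ℝ} (h0 : 0 < ε) (h1 : ε < 1) :
    ∑' i, (volume (hcube (c i) (r i)))⁻¹ *
        ∫⁻ x in ccube (c i) (r i * (1 - ε)), ∫⁻ y in ccube (c i) (r i * (1 - ε)),
          ENNReal.ofReal |f x - f y| ≤
      C * (∑' i, volume (hcube (c i) (r i))) ^ (1 - 1 / p) := by
  rcases isEmpty_or_nonempty ι with hι | hι
  · simp
  obtain ⟨hden⟩ := nonempty_denumerable (ι × ℕ)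
  let e : ℕ ≃ ι × ℕ := (Denumerable.eqv (ι × ℕ)).symm
  let Q : ι × ℕ → Set (Fin n → ℝ) := fun q => diagCube (c q.1) (r q.1) ε q.2
  have hQH : ∀ q, Q q ⊆ hcube (c q.1) (r q.1) := fun q => diagCube_subset _ (hr _) h0 h1 _
  have hQd : Pairwise fun q q' => Disjoint (interior (Q q)) (interior (Q q')) := by
    rintro ⟨i, j⟩ ⟨i', k⟩ hne
    by_cases hi : i = i'
    · subst hi
      have hjk : j ≠ k := fun h => hne (by rw [h])
      rcases lt_or_gt_of_ne hjk with h | h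
      · exact diagCube_interior_disjoint hn _ (hr i) h0 h1 h
      · exact (diagCube_interior_disjoint hn _ (hr i) h0 h1 h).symm
    · exact (hd hi).mono (interior_subset.trans (hQH _)) (interior_subset.trans (hQH _))
  have hpack : IsPackingIn Q₀ (Q ∘ e) := by
    refine ⟨fun m => ⟨⟨_, _, ?_, rfl⟩, (hQH _).trans (hsub _)⟩, fun m m' hm => ?_⟩
    · have := hr (e m).1
      have : 0 < 1 - ε := by linarith
      positivity
    · exact Set.disjoint_iff_inter_eq_empty.1 (hQd (e.injective.ne hm))
  have key := hC _ hpack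
  have hvol : ∑' m, volume ((Q ∘ e) m) ≤ ∑' i, volume (hcube (c i) (r i)) := by
    calc ∑' m, volume ((Q ∘ e) m) = ∑' q, volume (Q q) := e.tsum_eq fun q => volume (Q q)
      _ = ∑' q, volume (interior (Q q)) :=
        tsum_congr fun q => (volume_interior_ccube _ _).symm
      _ ≤ volume (⋃ q, interior (Q q)) :=
        tsum_meas_le_meas_iUnion_of_disjoint _ (fun q => isOpen_interior.measurableSet) hQd
      _ ≤ volume (⋃ i, hcube (c i) (r i)) :=
        measure_mono (Set.iUnion_subset fun q =>
          (interior_subset.trans (hQH q)).trans (Set.subset_iUnion_of_subset q.1 subset_rfl))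
      _ ≤ _ := measure_iUnion_le _
  have hexp : 0 ≤ 1 - 1 / p := by
    rw [sub_nonneg, div_le_one (by linarith)]
    exact hp.le
  let F : ι × ℕ → ℝ≥0∞ := fun q =>
    (volume (Q q))⁻¹ * ∫⁻ x in Q q, ∫⁻ y in Q q, ENNReal.ofReal |f x - f y|
  have hzero : ∀ i, Q (i, 0) = ccube (c i) (r i * (1 - ε)) := fun i => by
    simp [Q, diagCube]
  calc _ ≤ ∑' i, F (i, 0) := by
        refine ENNReal.tsum_le_tsum fun i => ?_
        simp only [F]
        have hle : volume (Q (i, 0)) ≤ volume (hcube (c i) (r i)) := measure_mono (hQH (i, 0))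
        rw [hzero] at hle ⊢
        gcongr
    _ ≤ ∑' q, F q :=
        ENNReal.tsum_comp_le_tsum_of_injective (f := fun i : ι => (i, 0))
          (fun i j h => (Prod.mk.inj h).1) F
    _ = ∑' m, F (e m) := (e.tsum_eq F).symm
    _ ≤ _ := key
    _ ≤ _ := by gcongr

lemma iUnion_ccube_shrunk {n : ℕ} (hn : n ≠ 0) (c : Fin n → ℝ) {r : ℝ} (hr : 0 < r) :
    ⋃ j : ℕ, ccube c (r * (1 - 1 / ((j : ℝ) + 2))) = hcube c r := by
  have : Nonempty (Fin n) := ⟨⟨0, Nat.pos_of_ne_zero hn⟩⟩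
  ext x
  simp only [Set.mem_iUnion]
  constructor
  · rintro ⟨j, hj⟩ i -
    obtain ⟨hx1, hx2⟩ := hj i trivial
    have : 0 < r * (1 / ((j : ℝ) + 2)) := by positivity
    exact ⟨hx1, by nlinarith⟩
  · intro hx
    obtain ⟨i₀, hi₀⟩ := Finite.exists_max fun i => x i - c i
    have h1 : 0 < (c i₀ + r - x i₀) / r := div_pos (sub_pos.2 (hx i₀ trivial).2) hr
    obtain ⟨j, hj⟩ := exists_nat_one_div_lt h1
    refine ⟨j, fun i _ => ⟨(hx i trivial).1, ?_⟩⟩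
    have h2 : 1 / ((j : ℝ) + 2) ≤ 1 / ((j : ℝ) + 1) := by gcongr; norm_num
    have h3 := (lt_div_iff₀ hr).1 (h2.trans_lt hj)
    have h4 := hi₀ i
    nlinarith

lemma tendsto_lintegral_shrunk {n : ℕ} (hn : n ≠ 0) {g : (Fin n → ℝ) → (Fin n → ℝ) → ℝ≥0∞}
    (hg : Measurable (Function.uncurry g)) (c : Fin n → ℝ) {r : ℝ} (hr : 0 < r) :
    Filter.Tendsto (fun j : ℕ => ∫⁻ x in ccube c (r * (1 - 1 / ((j : ℝ) + 2))),
        ∫⁻ y in ccube c (r * (1 - 1 / ((j : ℝ) + 2))), g x y) Filter.atTop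
      (nhds (∫⁻ x in hcube c r, ∫⁻ y in hcube c r, g x y)) := by
  let A : ℕ → Set (Fin n → ℝ) := fun j => ccube c (r * (1 - 1 / ((j : ℝ) + 2)))
  have hA : Monotone A := by
    intro j k hjk x hx i _
    refine ⟨(hx i trivial).1, (hx i trivial).2.trans ?_⟩
    gcongr
  have hAm : ∀ j, MeasurableSet (A j) := fun j => MeasurableSet.univ_pi fun _ => measurableSet_Icc
  let ν := ((volume : Measure (Fin n → ℝ)).prod volume).withDensity (Function.uncurry g)
  have hν : ∀ s, MeasurableSet s → ν (s ×ˢ s) = ∫⁻ x in s, ∫⁻ y in s, g x y := fun s hs => by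
    rw [withDensity_apply _ (hs.prod hs), setLIntegral_prod _ hg.aemeasurable]
    rfl
  have ht := tendsto_measure_iUnion_atTop (μ := ν) (s := fun j => A j ×ˢ A j)
    fun j k h => Set.prod_mono (hA h) (hA h)
  rw [Set.iUnion_prod_of_monotone hA hA] at ht
  simp only [A] at ht
  rw [iUnion_ccube_shrunk hn c hr, hν _ (measurableSet_hcube c r)] at ht
  exact ht.congr fun j => hν _ (hAm j)

/-- The Garsia–Rodemich inequality for countable (possibly finite) families of disjoint half-open
cubes. -/
lemma IsGaRoBound.tsum_hcube_le {n : ℕ} (hn : n ≠ 0) {p : ℝ} (hp : 1 < p)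
    {f : (Fin n → ℝ) → ℝ} (hf : Measurable f) {Q₀ : Set (Fin n → ℝ)} {C : ℝ≥0∞}
    (hC : IsGaRoBound p f Q₀ C)
    {ι : Type*} [Countable ι] (c : ι → Fin n → ℝ) (r : ι → ℝ) (hr : ∀ i, 0 < r i)
    (hd : Pairwise fun i j => Disjoint (hcube (c i) (r i)) (hcube (c j) (r j)))
    (hsub : ∀ i, hcube (c i) (r i) ⊆ Q₀) :
    ∑' i, (volume (hcube (c i) (r i)))⁻¹ *
        ∫⁻ x in hcube (c i) (r i), ∫⁻ y in hcube (c i) (r i), ENNReal.ofReal |f x - f y| ≤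
      C * (∑' i, volume (hcube (c i) (r i))) ^ (1 - 1 / p) := by
  have hg : Measurable (Function.uncurry fun x y => ENNReal.ofReal |f x - f y|) := by
    simp only [Function.uncurry_def]
    fun_prop
  refine tsum_le_of_sum_le' zero_le fun s => ?_
  have ht := tendsto_finsetSum s fun i _ =>
    ENNReal.Tendsto.const_mul (tendsto_lintegral_shrunk hn hg (c i) (hr i))
      (Or.inr (ENNReal.inv_ne_top.2 (volume_hcube_ne_zero (c i) (hr i))))
  refine le_of_tendsto' ht fun j => ?_
  refine (ENNReal.sum_le_tsum s).trans (hC.tsum_shrunk_le hn hp c r hr hd hsub ?_ ?_)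
  · positivity
  · rw [div_lt_one (by positivity)]
    linarith [(Nat.cast_nonneg j : (0 : ℝ) ≤ j)]

/-- The index of the cell containing `x` in the grid of mesh `l / 2 ^ k` based at `a`. -/
def dyIdx {n : ℕ} (a : Fin n → ℝ) (l : ℝ) (k : ℕ) (x : Fin n → ℝ) : Fin n → ℤ :=
  fun i => ⌊(x i - a i) / (l / 2 ^ k)⌋

/-- The lower corner of the cell of index `m` in the grid of mesh `l / 2 ^ k` based at `a`. -/
def dyCorner {n : ℕ} (a : Fin n → ℝ) (l : ℝ) (k : ℕ) (m : Fin n → ℤ) : Fin n → ℝ :=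
  fun i => a i + l / 2 ^ k * m i

/-- The half-open cell of index `m` in the grid of mesh `l / 2 ^ k` based at `a`. -/
def dyCell {n : ℕ} (a : Fin n → ℝ) (l : ℝ) (k : ℕ) (m : Fin n → ℤ) : Set (Fin n → ℝ) :=
  hcube (dyCorner a l k m) (l / 2 ^ k)

lemma mem_dyCell {n : ℕ} {a : Fin n → ℝ} {l : ℝ} (hl : 0 < l) {k : ℕ} {m : Fin n → ℤ}
    {x : Fin n → ℝ} : x ∈ dyCell a l k m ↔ dyIdx a l k x = m := by
  have h : 0 < l / 2 ^ k := by positivity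
  simp only [dyCell, hcube, dyCorner, dyIdx, funext_iff, Set.mem_univ_pi, Set.mem_Ico,
    Int.floor_eq_iff, le_div_iff₀ h, div_lt_iff₀ h]
  refine forall_congr' fun i => and_congr ?_ ?_ <;> constructor <;> intro h <;> nlinarith

lemma mem_dyCell_self {n : ℕ} (a : Fin n → ℝ) {l : ℝ} (hl : 0 < l) (k : ℕ) (x : Fin n → ℝ) :
    x ∈ dyCell a l k (dyIdx a l k x) :=
  (mem_dyCell hl).2 rfl

lemma dyIdx_eq_of_le {n : ℕ} {a : Fin n → ℝ} {l : ℝ} {j k : ℕ} (hjk : j ≤ k) {x y : Fin n → ℝ}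
    (h : dyIdx a l k x = dyIdx a l k y) : dyIdx a l j x = dyIdx a l j y := by
  obtain ⟨d, rfl⟩ := Nat.exists_eq_add_of_le hjk
  have key : ∀ (z : Fin n → ℝ) i, dyIdx a l j z i = dyIdx a l (j + d) z i / ((2 ^ d : ℕ) : ℤ) := by
    intro z i
    rw [dyIdx, dyIdx, ← Int.floor_div_natCast]
    congr 1
    push_cast
    rw [pow_add]
    field_simp
  funext i
  rw [key, key, h]

lemma dyCell_subset {n : ℕ} {a : Fin n → ℝ} {l : ℝ} (hl : 0 < l) {j k : ℕ} (hjk : j ≤ k)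
    {m m' : Fin n → ℤ} {x : Fin n → ℝ} (hx : x ∈ dyCell a l k m) (hx' : x ∈ dyCell a l j m') :
    dyCell a l k m ⊆ dyCell a l j m' := by
  intro y hy
  rw [mem_dyCell hl] at *
  rw [← hx']
  exact dyIdx_eq_of_le hjk (hy.trans hx.symm)

lemma dyCell_zero {n : ℕ} (a : Fin n → ℝ) (l : ℝ) : dyCell a l 0 0 = hcube a l := by
  have h : dyCorner a l 0 0 = a := by
    funext i
    simp [dyCorner]
  simp [dyCell, h]

lemma volume_dyCell_succ {n : ℕ} (a : Fin n → ℝ) {l : ℝ} (k : ℕ)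
    (m m' : Fin n → ℤ) : volume (dyCell a l k m) = 2 ^ n * volume (dyCell a l (k + 1) m') := by
  rw [dyCell, dyCell, volume_hcube, volume_hcube, ← mul_pow]
  congr 1
  rw [show l / 2 ^ k = 2 * (l / 2 ^ (k + 1)) by rw [pow_succ]; field_simp,
    ENNReal.ofReal_mul (by norm_num)]
  simp

/-- Almost every point of `E` lies in a dyadic cell more than half of which is in `E`. -/
lemma ae_exists_dense_dyCell {n : ℕ} (a : Fin n → ℝ) {l : ℝ} (hl : 0 < l) (E : Set (Fin n → ℝ)) :
    ∀ᵐ x ∂volume.restrict E, ∃ k, volume (dyCell a l k (dyIdx a l k x)) <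
      2 * volume (E ∩ dyCell a l k (dyIdx a l k x)) := by
  filter_upwards [IsUnifLocDoublingMeasure.ae_tendsto_measure_inter_div
    (volume : Measure (Fin n → ℝ)) E 1] with x hx
  let δ : ℕ → ℝ := fun k => l / 2 ^ k / 2
  let w : ℕ → Fin n → ℝ := fun k i => dyCorner a l k (dyIdx a l k x) i + δ k
  have hδ : ∀ k, 0 < δ k := fun k => by positivity
  have hball : ∀ k, Metric.closedBall (w k) (δ k) =
      ccube (dyCorner a l k (dyIdx a l k x)) (l / 2 ^ k) := by
    intro k
    rw [closedBall_pi _ (hδ k).le, ccube]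
    refine Set.pi_congr rfl fun i _ => ?_
    rw [Real.closedBall_eq_Icc]
    congr 1 <;> simp only [w, δ] <;> ring
  have hlim : Filter.Tendsto δ Filter.atTop (nhdsWithin 0 (Set.Ioi 0)) := by
    refine tendsto_nhdsWithin_iff.2 ⟨?_, Filter.Eventually.of_forall hδ⟩
    have h := (tendsto_pow_atTop_nhds_zero_of_lt_one (r := (1 / 2 : ℝ))
      (by norm_num) (by norm_num)).const_mul (l / 2)
    rw [mul_zero] at h
    refine h.congr fun k => ?_
    simp only [δ, one_div, inv_pow]
    ring
  have hxw : ∀ k, x ∈ Metric.closedBall (w k) (1 * δ k) := by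
    intro k
    rw [one_mul, hball]
    exact Set.pi_mono (fun i _ => Set.Ico_subset_Icc_self) (mem_dyCell_self a hl k x)
  have ht := hx w δ hlim (Filter.Eventually.of_forall hxw)
  obtain ⟨k, hk⟩ := (ht.eventually (lt_mem_nhds ENNReal.one_half_lt_one)).exists
  refine ⟨k, ?_⟩
  have hae := hcube_ae_eq_ccube (dyCorner a l k (dyIdx a l k x)) (l / 2 ^ k)
  rw [hball, ← measure_congr hae, ← measure_congr ((ae_eq_refl E).inter hae)] at hk
  have h2 := ENNReal.mul_lt_of_lt_div hk
  have h3 := ENNReal.mul_lt_mul_right (a := 2) (by norm_num) (by norm_num) h2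
  rwa [← mul_assoc, ENNReal.mul_inv_cancel (by norm_num) (by norm_num), one_mul] at h3

/-- A cell at most half of which is in `E`, with a child more than half of which is in `E`. -/
def IsSelected {n : ℕ} (a : Fin n → ℝ) (l : ℝ) (E : Set (Fin n → ℝ)) (k : ℕ) (m : Fin n → ℤ) :
    Prop :=
  2 * volume (E ∩ dyCell a l k m) ≤ volume (dyCell a l k m) ∧
    ∃ y ∈ dyCell a l k m, volume (dyCell a l (k + 1) (dyIdx a l (k + 1) y)) <
      2 * volume (E ∩ dyCell a l (k + 1) (dyIdx a l (k + 1) y))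

lemma IsSelected.volume_le {n : ℕ} {a : Fin n → ℝ} {l : ℝ} (hl : 0 < l) {E : Set (Fin n → ℝ)}
    {k : ℕ} {m : Fin n → ℤ} (h : IsSelected a l E k m) :
    volume (dyCell a l k m) ≤ 2 ^ (n + 1) * volume (E ∩ dyCell a l k m) := by
  obtain ⟨-, y, hy, hlt⟩ := h
  rw [volume_dyCell_succ a k m (dyIdx a l (k + 1) y), pow_succ, mul_assoc]
  gcongr
  refine hlt.le.trans ?_
  gcongr
  exact dyCell_subset hl k.le_succ (mem_dyCell_self a hl _ y) hy

lemma IsSelected.subset {n : ℕ} {a : Fin n → ℝ} {l : ℝ} (hl : 0 < l) {E : Set (Fin n → ℝ)}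
    (hE : E ⊆ hcube a l) {k : ℕ} {m : Fin n → ℤ} (h : IsSelected a l E k m) :
    dyCell a l k m ⊆ hcube a l := by
  have hpos : volume (E ∩ dyCell a l k m) ≠ 0 := by
    intro h0
    have hle := h.volume_le hl
    rw [h0, mul_zero, nonpos_iff_eq_zero] at hle
    exact volume_hcube_ne_zero _ (by positivity) hle
  obtain ⟨x, hxE, hx⟩ := nonempty_of_measure_ne_zero hpos
  rw [← dyCell_zero a l] at hE ⊢
  exact dyCell_subset hl k.zero_le hx (hE hxE)

/-- Covering of a set filling at most half of a cube by disjoint subcubes, in each of which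
the set has density at most `1 / 2` and at least `1 / 2 ^ (n + 1)`. -/
lemma exists_hcube_cover {n : ℕ} (a : Fin n → ℝ) {l : ℝ} (hl : 0 < l) {E : Set (Fin n → ℝ)}
    (hEm : MeasurableSet E) (hE : E ⊆ hcube a l) (hvol : 2 * volume E ≤ volume (hcube a l)) :
    ∃ (ι : Type) (_ : Countable ι) (c : ι → Fin n → ℝ) (r : ι → ℝ), (∀ i, 0 < r i) ∧
      (Pairwise fun i j => Disjoint (hcube (c i) (r i)) (hcube (c j) (r j))) ∧
      (∀ i, hcube (c i) (r i) ⊆ hcube a l) ∧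
      (∀ i, 2 * volume (E ∩ hcube (c i) (r i)) ≤ volume (hcube (c i) (r i))) ∧
      (∀ i, volume (hcube (c i) (r i)) ≤ 2 ^ (n + 1) * volume (E ∩ hcube (c i) (r i))) ∧
      E ≤ᵐ[volume] ⋃ i, hcube (c i) (r i) := by
  classical
  let M : Set (ℕ × (Fin n → ℤ)) := {q | IsSelected a l E q.1 q.2 ∧
    ∀ x ∈ dyCell a l q.1 q.2, ∀ j < q.1, ¬ IsSelected a l E j (dyIdx a l j x)}
  refine ⟨M, inferInstance, fun q => dyCorner a l q.1.1 q.1.2, fun q => l / 2 ^ q.1.1,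
    fun q => by positivity, ?_, fun q => q.2.1.subset hl hE, fun q => q.2.1.1,
    fun q => q.2.1.volume_le hl, ?_⟩
  · rintro ⟨⟨k, m⟩, hq⟩ ⟨⟨k', m'⟩, hq'⟩ hne
    rw [Set.disjoint_left]
    intro x (hx : x ∈ dyCell a l k m) (hx' : x ∈ dyCell a l k' m')
    rcases lt_trichotomy k k' with h | rfl | h
    · exact hq'.2 x hx' k h (by rw [(mem_dyCell hl).1 hx]; exact hq.1)
    · apply hne
      have : m = m' := by rw [← (mem_dyCell hl).1 hx, ← (mem_dyCell hl).1 hx']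
      subst this
      rfl
    · exact hq.2 x hx k' h (by rw [(mem_dyCell hl).1 hx']; exact hq'.1)
  · have hae := (ae_restrict_iff' hEm).1 (ae_exists_dense_dyCell a hl E)
    filter_upwards [hae] with x hx hxE
    have hdense := hx hxE
    have hsel : ∃ k, IsSelected a l E k (dyIdx a l k x) := by
      have hspec := Nat.find_spec hdense
      rcases hk : Nat.find hdense with _ | k
      · rw [hk] at hspec
        have h0 : dyIdx a l 0 x = 0 :=
          (mem_dyCell hl).1 (by rw [dyCell_zero]; exact hE hxE)
        rw [h0, dyCell_zero, Set.inter_eq_left.2 hE] at hspec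
        exact absurd hvol (not_le.2 hspec)
      · rw [hk] at hspec
        exact ⟨k, not_lt.1 (Nat.find_min hdense (by omega)), x, mem_dyCell_self a hl k x, hspec⟩
    refine Set.mem_iUnion.2 ⟨⟨(Nat.find hsel, dyIdx a l (Nat.find hsel) x),
      Nat.find_spec hsel, fun y hy j hj => ?_⟩, mem_dyCell_self a hl _ x⟩
    rw [dyIdx_eq_of_le hj.le ((mem_dyCell hl).1 hy)]
    exact Nat.find_min hsel hj

/-- On a set `H` at most half of which is in `E`, the excess of `f` over `c` is controlled by the
mean oscillation of `f`, when `f ≤ c` off `E`. -/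
lemma lintegral_inter_le_osc {α : Type*} [MeasurableSpace α] {μ : Measure α} [SFinite μ]
    {f : α → ℝ} (hf : Measurable f) {E H : Set α} (hE : MeasurableSet E) (hH : MeasurableSet H)
    (hH0 : μ H ≠ 0) (hHtop : μ H ≠ ⊤) (hvol : 2 * μ (E ∩ H) ≤ μ H) {c : ℝ}
    (hc : ∀ x ∈ H \ E, f x ≤ c) :
    ∫⁻ x in E ∩ H, ENNReal.ofReal (f x - c) ∂μ ≤
      (μ H)⁻¹ * ∫⁻ x in H, ∫⁻ y in H, ENNReal.ofReal |f x - f y| ∂μ ∂μ := by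
  have hA := hE.inter hH
  have hB := hH.diff hE
  set A := E ∩ H
  set B := H \ E
  have hHAB : μ H = μ A + μ B := by
    rw [← measure_inter_add_sdiff H hE, Set.inter_comm]
  have hAB : μ H ≤ 2 * μ B := by
    have hAtop : μ A ≠ ⊤ := ne_top_of_le_ne_top hHtop (measure_mono Set.inter_subset_right)
    have h1 : μ A + μ A ≤ μ A + μ B := by rwa [← two_mul, ← hHAB]
    have h2 : μ A ≤ μ B := (ENNReal.add_le_add_iff_left hAtop).1 h1
    rw [hHAB, two_mul]
    gcongr
  let g : α → α → ℝ≥0∞ := fun x y => ENNReal.ofReal |f x - f y|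
  have hg : Measurable (Function.uncurry g) := by
    simp only [Function.uncurry_def, g]
    fun_prop
  have hAH : A ∪ B = H := by
    simp only [A, B]
    rw [Set.inter_comm, Set.inter_union_sdiff]
  have hdisj : Disjoint A B := by
    rw [Set.disjoint_left]
    exact fun x hx hx' => hx'.2 hx.1
  have hsym : ∫⁻ x in B, ∫⁻ y in A, g x y ∂μ ∂μ = ∫⁻ x in A, ∫⁻ y in B, g x y ∂μ ∂μ := by
    rw [lintegral_lintegral_swap hg.aemeasurable]
    simp only [g, abs_sub_comm]
  have hlow : 2 * ∫⁻ x in A, ∫⁻ y in B, g x y ∂μ ∂μ ≤ ∫⁻ x in H, ∫⁻ y in H, g x y ∂μ ∂μ := by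
    calc 2 * ∫⁻ x in A, ∫⁻ y in B, g x y ∂μ ∂μ
        = ∫⁻ x in A, ∫⁻ y in B, g x y ∂μ ∂μ + ∫⁻ x in B, ∫⁻ y in A, g x y ∂μ ∂μ := by
          rw [hsym, two_mul]
      _ ≤ ∫⁻ x in A, ∫⁻ y in H, g x y ∂μ ∂μ + ∫⁻ x in B, ∫⁻ y in H, g x y ∂μ ∂μ := by
          gcongr with x x
          · exact Set.sdiff_subset
          · exact Set.inter_subset_right
      _ = ∫⁻ x in H, ∫⁻ y in H, g x y ∂μ ∂μ := by
          rw [← lintegral_union hB hdisj, hAH]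
  have hmul : (∫⁻ x in A, ENNReal.ofReal (f x - c) ∂μ) * μ B ≤
      ∫⁻ x in A, ∫⁻ y in B, g x y ∂μ ∂μ := by
    rw [← lintegral_mul_const _ (by fun_prop)]
    refine lintegral_mono fun x => ?_
    simp only
    rw [← setLIntegral_const]
    refine setLIntegral_mono' hB fun y hy => ENNReal.ofReal_le_ofReal ?_
    exact (sub_le_sub_left (hc y hy) _).trans (le_abs_self _)
  rw [mul_comm, ← div_eq_mul_inv, ENNReal.le_div_iff_mul_le (Or.inl hH0) (Or.inl hHtop)]
  calc _ ≤ (∫⁻ x in A, ENNReal.ofReal (f x - c) ∂μ) * (2 * μ B) := by gcongr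
    _ = 2 * ((∫⁻ x in A, ENNReal.ofReal (f x - c) ∂μ) * μ B) := by ring
    _ ≤ 2 * ∫⁻ x in A, ∫⁻ y in B, g x y ∂μ ∂μ := by gcongr
    _ ≤ _ := hlow

lemma IsGaRoBound.setLIntegral_sub_le {n : ℕ} {p : ℝ} (hp : 1 < p)
    {f : (Fin n → ℝ) → ℝ} (hf : Measurable f) {a : Fin n → ℝ} {l : ℝ} (hl : 0 < l) {C : ℝ≥0∞}
    (hC : IsGaRoBound p f (ccube a l) C) {E : Set (Fin n → ℝ)} (hEm : MeasurableSet E)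
    (hE : E ⊆ hcube a l) (hvol : 2 * volume E ≤ volume (hcube a l)) {c : ℝ}
    (hc : ∀ x ∈ hcube a l \ E, f x ≤ c) :
    ∫⁻ x in E, ENNReal.ofReal (f x - c) ≤ C * (2 ^ (n + 1) * volume E) ^ (1 - 1 / p) := by
  rcases eq_or_ne n 0 with rfl | hn
  · have hE0 : E = ∅ := by
      by_contra hne
      obtain ⟨x, hx⟩ := Set.nonempty_iff_ne_empty.2 hne
      have hEu : E = Set.univ := Set.eq_univ_of_forall fun y => Subsingleton.elim x y ▸ hx
      rw [hEu, Set.univ_subset_iff] at hE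
      rw [hEu, ← hE, volume_hcube, pow_zero, mul_one] at hvol
      exact absurd hvol (by norm_num)
    simp [hE0]
  obtain ⟨ι, hι, b, r, hr, hd, hsub, hhalf, hup, hcov⟩ := exists_hcube_cover a hl hEm hE hvol
  have hexp : 0 ≤ 1 - 1 / p := by
    rw [sub_nonneg, div_le_one (by linarith)]
    exact hp.le
  have hcov' : E ≤ᵐ[volume] ⋃ i, E ∩ hcube (b i) (r i) := by
    filter_upwards [hcov] with x hx hxE
    rw [← Set.inter_iUnion]
    exact ⟨hxE, hx hxE⟩
  calc ∫⁻ x in E, ENNReal.ofReal (f x - c)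
      ≤ ∫⁻ x in ⋃ i, E ∩ hcube (b i) (r i), ENNReal.ofReal (f x - c) :=
        lintegral_mono' (Measure.restrict_mono_ae hcov') le_rfl
    _ ≤ ∑' i, ∫⁻ x in E ∩ hcube (b i) (r i), ENNReal.ofReal (f x - c) := lintegral_iUnion_le _ _
    _ ≤ ∑' i, (volume (hcube (b i) (r i)))⁻¹ *
        ∫⁻ x in hcube (b i) (r i), ∫⁻ y in hcube (b i) (r i), ENNReal.ofReal |f x - f y| :=
        ENNReal.tsum_le_tsum fun i => lintegral_inter_le_osc hf hEm (measurableSet_hcube _ _)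
          (volume_hcube_ne_zero _ (hr i)) (volume_hcube_ne_top _ _) (hhalf i)
          fun x hx => hc x ⟨hsub i hx.1, hx.2⟩
    _ ≤ C * (∑' i, volume (hcube (b i) (r i))) ^ (1 - 1 / p) :=
        hC.tsum_hcube_le hn hp hf b r hr hd fun i => (hsub i).trans
          (Set.pi_mono fun _ _ => Set.Ico_subset_Icc_self)
    _ ≤ C * (∑' i, 2 ^ (n + 1) * volume (E ∩ hcube (b i) (r i))) ^ (1 - 1 / p) := by
        gcongr with i
        exact hup i
    _ ≤ C * (2 ^ (n + 1) * volume E) ^ (1 - 1 / p) := by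
        rw [ENNReal.tsum_mul_left]
        gcongr
        refine (tsum_meas_le_meas_iUnion_of_disjoint _
          (fun i => hEm.inter (measurableSet_hcube _ _)) fun i j hij =>
            (hd hij).mono Set.inter_subset_right Set.inter_subset_right).trans ?_
        exact measure_mono (Set.iUnion_subset fun i => Set.inter_subset_left)

section Rearrangement

variable {α : Type*} [MeasurableSpace α] {μ : Measure α} {f : α → ℝ}

lemma distFun_antitone : Antitone (distFun μ f) :=
  fun _ _ h => measure_mono fun _ hx => lt_of_le_of_lt h hx

lemma rearr_antitone : Antitone (rearr μ f) := by
  intro s t h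
  refine sInf_le_sInf (Set.image_mono ?_)
  rintro u ⟨hu, hus⟩
  exact ⟨hu, hus.trans (ENNReal.ofReal_le_ofReal h)⟩

lemma lt_distFun_of_lt_rearr {s v : ℝ} (hv : 0 < v) (h : ENNReal.ofReal v < rearr μ f s) :
    ENNReal.ofReal s < distFun μ f v := by
  by_contra hle
  have hmem : rearr μ f s ≤ ENNReal.ofReal v := sInf_le ⟨v, ⟨hv, not_lt.1 hle⟩, rfl⟩
  exact absurd hmem (not_le.2 h)

lemma distFun_le_of_rearr_lt {t v : ℝ} (h : rearr μ f t < ENNReal.ofReal v) :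
    distFun μ f v ≤ ENNReal.ofReal t := by
  obtain ⟨_, ⟨s, ⟨hs, hst⟩, rfl⟩, hsv⟩ := sInf_lt_iff.1 h
  exact (distFun_antitone (ENNReal.ofReal_lt_ofReal_iff'.1 hsv).1.le).trans hst

lemma distFun_rearr_le {t : ℝ} (h : rearr μ f t ≠ ⊤) :
    distFun μ f (rearr μ f t).toReal ≤ ENNReal.ofReal t := by
  set c := (rearr μ f t).toReal with hc
  have hunion : {x | c < |f x|} = ⋃ k : ℕ, {x | c + 1 / ((k : ℝ) + 1) < |f x|} := by
    ext x
    simp only [Set.mem_ofPred_eq, Set.mem_iUnion]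
    constructor
    · intro hx
      obtain ⟨k, hk⟩ := exists_nat_one_div_lt (sub_pos.2 hx)
      exact ⟨k, by linarith⟩
    · rintro ⟨k, hk⟩
      have : 0 < 1 / ((k : ℝ) + 1) := by positivity
      linarith
  have hmono : Monotone fun k : ℕ => {x | c + 1 / ((k : ℝ) + 1) < |f x|} := by
    intro j k hjk x (hx : c + 1 / ((j : ℝ) + 1) < |f x|)
    refine lt_of_le_of_lt ?_ hx
    gcongr
  rw [distFun, hunion]
  refine le_of_tendsto' (tendsto_measure_iUnion_atTop hmono) fun k => ?_
  refine distFun_le_of_rearr_lt (μ := μ) (f := f) ?_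
  rw [ENNReal.lt_ofReal_iff_toReal_lt h, ← hc]
  have : 0 < 1 / ((k : ℝ) + 1) := by positivity
  linarith

lemma rearr_ne_top (hf : Integrable f μ) {s : ℝ} (hs : 0 < s) : rearr μ f s ≠ ⊤ := by
  set I := ∫⁻ x, ‖f x‖ₑ ∂μ
  have hI : I ≠ ⊤ := hf.2.ne
  have hv : 0 < I.toReal / s + 1 := by positivity
  refine ne_top_of_le_ne_top ENNReal.ofReal_ne_top
    (sInf_le ⟨I.toReal / s + 1, ⟨hv, ?_⟩, rfl⟩)
  have hsub : {x | I.toReal / s + 1 < |f x|} ⊆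
      {x | ENNReal.ofReal (I.toReal / s + 1) ≤ ‖f x‖ₑ} := by
    intro x (hx : I.toReal / s + 1 < |f x|)
    simp only [Set.mem_ofPred_eq, Real.enorm_eq_ofReal_abs]
    exact ENNReal.ofReal_le_ofReal hx.le
  refine (measure_mono hsub).trans
    ((meas_ge_le_lintegral_div hf.1.enorm (by simpa using hv) ENNReal.ofReal_ne_top).trans ?_)
  refine ENNReal.div_le_of_le_mul ?_
  rw [← ENNReal.ofReal_mul hs.le, ENNReal.le_ofReal_iff_toReal_le hI (by positivity)]
  rw [mul_add, mul_div_cancel₀ _ hs.ne']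
  linarith

lemma lintegral_rearr_sub_le (hf : Integrable f μ) (hfm : Measurable f) (hf0 : ∀ x, 0 ≤ f x)
    {c : ℝ} (hc : 0 ≤ c) (t : ℝ) :
    ∫⁻ s in Set.Ioc 0 t, (rearr μ f s - ENNReal.ofReal c) ≤
      ∫⁻ x, ENNReal.ofReal (f x - c) ∂μ := by
  have hmeas : Measurable fun s => (rearr μ f s - ENNReal.ofReal c).toReal :=
    (rearr_antitone.measurable.sub measurable_const).ennreal_toReal
  have hpos : ∫⁻ x, ENNReal.ofReal (f x - c) ∂μ =
      ∫⁻ x, ENNReal.ofReal (max (f x - c) 0) ∂μ := by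
    simp
  rw [hpos, lintegral_eq_lintegral_meas_lt (f := fun x => max (f x - c) 0) μ (ae_of_all _ fun x => le_max_right _ _)
    (by fun_prop)]
  calc ∫⁻ s in Set.Ioc 0 t, (rearr μ f s - ENNReal.ofReal c)
      = ∫⁻ s in Set.Ioc 0 t, ENNReal.ofReal (rearr μ f s - ENNReal.ofReal c).toReal := by
        refine setLIntegral_congr_fun measurableSet_Ioc fun s hs => ?_
        exact (ENNReal.ofReal_toReal (ENNReal.sub_ne_top (rearr_ne_top hf hs.1))).symm
    _ = ∫⁻ u in Set.Ioi 0, volume.restrict (Set.Ioc 0 t)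
          {s | u < (rearr μ f s - ENNReal.ofReal c).toReal} :=
        lintegral_eq_lintegral_meas_lt _ (ae_of_all _ fun x => ENNReal.toReal_nonneg)
          hmeas.aemeasurable
    _ ≤ _ := by
        refine setLIntegral_mono' measurableSet_Ioi fun u (hu : 0 < u) => ?_
        rw [Measure.restrict_apply (measurableSet_lt measurable_const hmeas)]
        have hset : {x | u < max (f x - c) 0} = {x | c + u < |f x|} := by
          ext x
          simp only [Set.mem_ofPred_eq, lt_max_iff, abs_of_nonneg (hf0 x)]
          constructor
          · rintro (h | h) <;> linarith
          · exact fun h => Or.inl (by linarith)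
        rw [hset]
        change _ ≤ distFun μ f (c + u)
        have hlt : ∀ s ∈ {s | u < (rearr μ f s - ENNReal.ofReal c).toReal} ∩ Set.Ioc 0 t,
            0 < s ∧ ENNReal.ofReal s < distFun μ f (c + u) := by
          rintro s ⟨hs, hs0, -⟩
          rw [Set.mem_ofPred_eq] at hs
          refine ⟨hs0, lt_distFun_of_lt_rearr (by positivity) ?_⟩
          rw [← ENNReal.ofReal_lt_iff_lt_toReal hu.le
            (ENNReal.sub_ne_top (rearr_ne_top hf hs0)), lt_tsub_iff_left] at hs
          rwa [ENNReal.ofReal_add hc hu.le]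
        rcases eq_or_ne (distFun μ f (c + u)) ⊤ with htop | htop
        · simp [htop]
        · calc _ ≤ volume (Set.Ioc 0 (distFun μ f (c + u)).toReal) := by
                refine measure_mono fun s hs => ⟨(hlt s hs).1, ?_⟩
                exact ((ENNReal.ofReal_lt_iff_lt_toReal (hlt s hs).1.le htop).1 (hlt s hs).2).le
            _ = _ := by simp [htop]

lemma mul_dstar_sub_rearr_le (hf : Integrable f μ) (hfm : Measurable f) (hf0 : ∀ x, 0 ≤ f x)
    {t : ℝ} (ht : 0 < t) :
    ENNReal.ofReal t * (dstar μ f t - rearr μ f t) ≤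
      ∫⁻ x in {x | (rearr μ f t).toReal < f x}, ENNReal.ofReal (f x - (rearr μ f t).toReal) ∂μ := by
  have htop := rearr_ne_top hf ht
  have ht0 : ENNReal.ofReal t ≠ 0 := by simpa using ht
  have hsupp : ∫⁻ x in {x | (rearr μ f t).toReal < f x},
      ENNReal.ofReal (f x - (rearr μ f t).toReal) ∂μ =
        ∫⁻ x, ENNReal.ofReal (f x - (rearr μ f t).toReal) ∂μ := by
    refine setLIntegral_eq_of_support_subset fun x hx => ?_
    simpa using hx
  rw [hsupp]
  refine le_trans ?_ (lintegral_rearr_sub_le hf hfm hf0 ENNReal.toReal_nonneg t)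
  rw [ENNReal.ofReal_toReal htop, ENNReal.mul_sub fun _ _ => ENNReal.ofReal_ne_top, dstar,
    ENNReal.mul_div_cancel ht0 ENNReal.ofReal_ne_top]
  refine le_trans (le_of_eq ?_) (lintegral_sub_le _ _ measurable_const)
  rw [setLIntegral_const, Real.volume_Ioc, sub_zero, mul_comm]

end Rearrangement

lemma rearr_congr_ae {α : Type*} [MeasurableSpace α] {μ : Measure α} {f g : α → ℝ}
    (h : ∀ᵐ x ∂μ, |f x| = |g x|) : rearr μ f = rearr μ g := by
  have hdist : ∀ s, distFun μ f s = distFun μ g s := fun s => by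
    refine measure_congr ?_
    filter_upwards [h] with x hx
    change (s < |f x|) = (s < |g x|)
    rw [hx]
  funext t
  simp only [rearr, hdist]

lemma dstar_congr_ae {α : Type*} [MeasurableSpace α] {μ : Measure α} {f g : α → ℝ}
    (h : ∀ᵐ x ∂μ, |f x| = |g x|) : dstar μ f = dstar μ g := by
  funext t
  simp only [dstar, rearr_congr_ae h]

lemma IsGaRoBound.congr_ae {n : ℕ} {p : ℝ} {f g : (Fin n → ℝ) → ℝ} {Q₀ : Set (Fin n → ℝ)}
    {C : ℝ≥0∞} (hC : IsGaRoBound p f Q₀ C) (h : f =ᵐ[volume.restrict Q₀] g) :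
    IsGaRoBound p g Q₀ C := by
  intro Q hQ
  refine le_trans (le_of_eq (tsum_congr fun i => ?_)) (hC Q hQ)
  have hi : f =ᵐ[volume.restrict (Q i)] g := ae_restrict_of_ae_restrict_of_subset (hQ.1 i).2 h
  congr 1
  refine lintegral_congr_ae ?_
  filter_upwards [hi] with x hx
  refine lintegral_congr_ae ?_
  filter_upwards [hi] with y hy
  rw [hx, hy]

lemma IsGaRoBound.mul_osc_le_of_measurable {n : ℕ} {p : ℝ} (hp : 1 < p)
    {f : (Fin n → ℝ) → ℝ} (hfm : Measurable f) (hf0 : ∀ x, 0 ≤ f x) {a : Fin n → ℝ} {l : ℝ}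
    (hl : 0 < l) (hf : IntegrableOn f (ccube a l)) {C : ℝ≥0∞}
    (hC : IsGaRoBound p f (ccube a l) C) {t : ℝ} (ht : 0 < t)
    (ht' : t ≤ (volume (ccube a l)).toReal / 4) :
    ENNReal.ofReal t * (dstar (volume.restrict (ccube a l)) f t -
        rearr (volume.restrict (ccube a l)) f t) ≤
      C * (2 ^ (n + 1) * ENNReal.ofReal t) ^ (1 - 1 / p) := by
  have hexp : 0 ≤ 1 - 1 / p := by
    rw [sub_nonneg, div_le_one (by linarith)]
    exact hp.le
  set c := (rearr (volume.restrict (ccube a l)) f t).toReal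
  have hm : MeasurableSet {x | c < f x} := measurableSet_lt measurable_const hfm
  have hE : volume ({x | c < f x} ∩ hcube a l) ≤ ENNReal.ofReal t := by
    refine le_trans ?_ (distFun_rearr_le (rearr_ne_top hf ht))
    simp only [distFun, abs_of_nonneg (hf0 _)]
    rw [Measure.restrict_apply hm]
    exact measure_mono (Set.inter_subset_inter_right _
      (Set.pi_mono fun _ _ => Set.Ico_subset_Icc_self))
  have hvol : 2 * volume ({x | c < f x} ∩ hcube a l) ≤ volume (hcube a l) := by
    have hae := measure_congr (hcube_ae_eq_ccube a l)
    rw [← hae] at ht'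
    calc _ ≤ 2 * ENNReal.ofReal t := by gcongr
      _ = ENNReal.ofReal (2 * t) := by
        rw [ENNReal.ofReal_mul (by norm_num)]
        simp
      _ ≤ ENNReal.ofReal (volume (hcube a l)).toReal := by
        refine ENNReal.ofReal_le_ofReal ?_
        linarith
      _ = _ := ENNReal.ofReal_toReal (volume_hcube_ne_top a l)
  refine (mul_dstar_sub_rearr_le hf hfm hf0 ht).trans ?_
  rw [Measure.restrict_restrict hm,
    ← setLIntegral_congr ((ae_eq_refl {x | c < f x}).inter (hcube_ae_eq_ccube a l))]
  refine (hC.setLIntegral_sub_le hp hfm hl (hm.inter (measurableSet_hcube a l))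
    Set.inter_subset_right hvol (c := c) fun x hx => ?_).trans ?_
  · by_contra hlt
    exact hx.2 ⟨not_le.1 hlt, hx.1⟩
  · gcongr

lemma IsGaRoBound.mul_osc_le {n : ℕ} {p : ℝ} (hp : 1 < p) {Q₀ : Set (Fin n → ℝ)} (hQ₀ : IsCube Q₀)
    {f : (Fin n → ℝ) → ℝ} (hf : IntegrableOn f Q₀) (hf0 : ∀ x, 0 ≤ f x) {C : ℝ≥0∞}
    (hC : IsGaRoBound p f Q₀ C) {t : ℝ} (ht : 0 < t) (ht' : t ≤ (volume Q₀).toReal / 4) :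
    ENNReal.ofReal t * (dstar (volume.restrict Q₀) f t - rearr (volume.restrict Q₀) f t) ≤
      2 ^ (((n : ℝ) + 1) * (1 - 1 / p)) * C * ENNReal.ofReal t ^ (1 - 1 / p) := by
  obtain ⟨a, l, hl, rfl⟩ := hQ₀
  change IntegrableOn f (ccube a l) at hf
  let g : (Fin n → ℝ) → ℝ := fun x => |hf.1.mk f x|
  have hgm : Measurable g := by
    have := hf.1.stronglyMeasurable_mk.measurable
    simp only [g]
    fun_prop
  have hfg : f =ᵐ[volume.restrict (ccube a l)] g := by
    filter_upwards [hf.1.ae_eq_mk] with x hx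
    simp only [g]
    rw [← hx, abs_of_nonneg (hf0 x)]
  have habs : ∀ᵐ x ∂volume.restrict (ccube a l), |f x| = |g x| := by
    filter_upwards [hfg] with x hx
    rw [hx]
  have hexp : 0 ≤ 1 - 1 / p := by
    rw [sub_nonneg, div_le_one (by linarith)]
    exact hp.le
  have h := (hC.congr_ae hfg).mul_osc_le_of_measurable hp hgm (fun x => abs_nonneg _) hl
    (hf.congr hfg) ht ht'
  rw [← dstar_congr_ae habs, ← rearr_congr_ae habs] at h
  refine h.trans (le_of_eq ?_)
  rw [ENNReal.mul_rpow_of_nonneg _ _ hexp, ENNReal.rpow_mul, ← Nat.cast_add_one,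
    ENNReal.rpow_natCast]
  ring

/-- for `f ∈ L¹(Q₀)`, `f ≥ 0`, with `GaRo_p(f,Q₀) < ∞`: for `0 < t < |Q₀|/4`,
`t (f**(t) - f*(t)) ≤ 2^{n/p'+1} GaRo_p(f,Q₀) t^{1/p'}`, and in particular
`sup_{0 < t ≤ |Q₀|/4} t^{1/p} (f**(t) - f*(t)) ≤ 2^{n/p'+1} GaRo_p(f,Q₀)`. -/
theorem osc_le_gaRo_small_t {n : ℕ} (p p' : ℝ) (hp : 1 < p) (hpp' : 1 / p + 1 / p' = 1)
    (Q₀ : Set (Fin n → ℝ)) (hQ₀ : IsCube Q₀)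
    (f : (Fin n → ℝ) → ℝ) (hf : IntegrableOn f Q₀) (hf0 : ∀ x, 0 ≤ f x)
    (hG : GaRo p f Q₀ ≠ ⊤) :
    (∀ t : ℝ, 0 < t → t < (volume Q₀).toReal / 4 →
      ENNReal.ofReal t *
          (dstar (volume.restrict Q₀) f t - rearr (volume.restrict Q₀) f t) ≤
        2 ^ ((n : ℝ) / p' + 1) * GaRo p f Q₀ * ENNReal.ofReal t ^ (1 / p')) ∧
    (⨆ (t : ℝ) (_ : 0 < t ∧ t ≤ (volume Q₀).toReal / 4),
        ENNReal.ofReal t ^ (1 / p) *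
          (dstar (volume.restrict Q₀) f t - rearr (volume.restrict Q₀) f t)) ≤
      2 ^ ((n : ℝ) / p' + 1) * GaRo p f Q₀ := by
  have hp0 : 0 < p := by linarith
  have hr : 1 - 1 / p = 1 / p' := by linarith
  have hmain : ∀ t : ℝ, 0 < t → t ≤ (volume Q₀).toReal / 4 →
      ENNReal.ofReal t *
          (dstar (volume.restrict Q₀) f t - rearr (volume.restrict Q₀) f t) ≤
        2 ^ ((n : ℝ) / p' + 1) * GaRo p f Q₀ * ENNReal.ofReal t ^ (1 / p') := by
    intro t ht ht'
    have ht0 : ENNReal.ofReal t ≠ 0 := by simpa using ht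
    have hK0 : (2 : ℝ≥0∞) ^ ((n : ℝ) / p' + 1) * ENNReal.ofReal t ^ (1 / p') ≠ 0 :=
      mul_ne_zero (ENNReal.rpow_pos two_pos ENNReal.ofNat_ne_top).ne'
        (ENNReal.rpow_pos (pos_iff_ne_zero.2 ht0) ENNReal.ofReal_ne_top).ne'
    have hKtop : (2 : ℝ≥0∞) ^ ((n : ℝ) / p' + 1) * ENNReal.ofReal t ^ (1 / p') ≠ ⊤ :=
      ENNReal.mul_ne_top (ENNReal.rpow_ne_top_of_ne_zero two_ne_zero ENNReal.ofNat_ne_top)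
        (ENNReal.rpow_ne_top_of_ne_zero ht0 ENNReal.ofReal_ne_top)
    rw [mul_right_comm, ← ENNReal.div_le_iff' hK0 hKtop]
    refine le_sInf fun C hC => ENNReal.div_le_of_le_mul' ?_
    have h := IsGaRoBound.mul_osc_le hp hQ₀ hf hf0 hC ht ht'
    rw [hr] at h
    refine h.trans ?_
    rw [mul_right_comm]
    gcongr
    · norm_num
    · have : 0 < 1 / p := by positivity
      rw [div_eq_mul_one_div (n : ℝ), add_mul, one_mul]
      linarith
  refine ⟨fun t ht ht' => hmain t ht ht'.le, iSup₂_le fun t ht => ?_⟩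
  have ht0 : ENNReal.ofReal t ≠ 0 := by simpa using ht.1
  have h := mul_le_mul_left (hmain t ht.1 ht.2) (ENNReal.ofReal t ^ (-(1 / p')))
  rw [mul_assoc _ (ENNReal.ofReal t ^ (1 / p')), ← ENNReal.rpow_add _ _ ht0 ENNReal.ofReal_ne_top,
    add_neg_cancel, ENNReal.rpow_zero, mul_one, mul_right_comm] at h
  rwa [show 1 / p = 1 + -(1 / p') by linarith, ENNReal.rpow_add _ _ ht0 ENNReal.ofReal_ne_top,
    ENNReal.rpow_one]
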